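/- The actor fluctuation process vanishes uniformly in time: for any state-action pair ξ = (x,a) and any T > 0, lim_{N→∞} sup_{t∈(0,T]} E | M_t^N(ξ) | = 0, where M_t^N(ξ) = (1/N) Σ_{k=0}^{⌊Nt⌋−1} ζ_k^N Q_k(x̃_k,ã_k) ∂_{θ(x,a)} log f_{θ_k}(x̃_k,ã_k) − (1/N) Σ_{k=0}^{⌊Nt⌋−1} Σ_{ξ'∈𝒳×𝒜} ζ_k^N Q_k(ξ') ∂_{θ(x,a)} log f_{θ_k}(ξ') σ_μ^{f_{θ_k}}(ξ'). -/

import Mathlib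

open MeasureTheory Filter Set
open scoped Classical

noncomputable section

def softmaxPol {X A : Type*} [Fintype A] (θ : X → A → ℝ) (x : X) (a : A) : ℝ :=
  Real.exp (θ x a) / ∑ a', Real.exp (θ x a')

def explorePol {X A : Type*} [Fintype A] (η : ℝ) (θ : X → A → ℝ) (x : X) (a : A) : ℝ :=
  η / (Fintype.card A : ℝ) + (1 - η) * softmaxPol θ x a

def zetaN (N k : ℕ) : ℝ := (1 + (k : ℝ) / (N : ℝ))⁻¹

def etaN (N k : ℕ) : ℝ := (1 + (Real.log ((k : ℝ) / (N : ℝ) + 1)) ^ 2)⁻¹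

def zetaT (t : ℝ) : ℝ := (1 + t)⁻¹

def etaT (t : ℝ) : ℝ := (1 + (Real.log (t + 1)) ^ 2)⁻¹

def IsPolicy {X A : Type*} [Fintype A] (f : X → A → ℝ) : Prop :=
  (∀ x a, 0 ≤ f x a) ∧ ∀ x, ∑ a, f x a = 1

def ptilde {X A : Type*} (γ : ℝ) (p : X → A → X → ℝ) (μ : X → ℝ)
    (x : X) (a : A) (x' : X) : ℝ :=
  γ * p x a x' + (1 - γ) * μ x'

def actorKer {X A : Type*} (γ : ℝ) (p : X → A → X → ℝ) (μ : X → ℝ) (f : X → A → ℝ) :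
    X × A → X × A → ℝ :=
  fun ξ ξ' => ptilde γ p μ ξ.1 ξ.2 ξ'.1 * f ξ'.1 ξ'.2

def criticKer {X A : Type*} (p : X → A → X → ℝ) (g : X → A → ℝ) :
    X × A → X × A → ℝ :=
  fun ξ ξ' => p ξ.1 ξ.2 ξ'.1 * g ξ'.1 ξ'.2

def kpow {S : Type*} [Fintype S] [DecidableEq S] (K : S → S → ℝ) : ℕ → S → S → ℝ
  | 0 => fun ξ ξ' => if ξ = ξ' then 1 else 0
  | n + 1 => fun ξ ξ' => ∑ y, K ξ y * kpow K n y ξ'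

def IsStationaryDist {S : Type*} [Fintype S] (K : S → S → ℝ) (d : S → ℝ) : Prop :=
  (∀ ξ, 0 ≤ d ξ) ∧ (∑ ξ, d ξ = 1) ∧ ∀ ξ', d ξ' = ∑ ξ, d ξ * K ξ ξ'

def pathSum {X A : Type*} [Fintype X] [Fintype A] [DecidableEq X]
    (p : X → A → X → ℝ) : ℕ → X → A → X → ℝ
  | 0 => fun x _ x' => if x = x' then 1 else 0
  | 1 => fun x a x' => p x a x'
  | n + 2 => fun x a x' => ∑ x₁ : X, ∑ a₁ : A, p x a x₁ * pathSum p (n + 1) x₁ a₁ x'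

section PoissonEquation

variable {S : Type*} [Fintype S] [DecidableEq S]

lemma kpow_row_sum {K : S → S → ℝ} (hK : ∀ ξ, ∑ y, K ξ y = 1) (n : ℕ) (ξ : S) :
    ∑ y, kpow K n ξ y = 1 := by
  induction n generalizing ξ with
  | zero => simp [kpow]
  | succ n ih =>
    simp only [kpow]
    rw [Finset.sum_comm]
    simp [← Finset.mul_sum, ih, hK]

lemma kpow_harmonic {K : S → S → ℝ} {v : S → ℝ} (hv : ∀ ξ, ∑ y, K ξ y * v y = v ξ)
    (n : ℕ) (ξ : S) : ∑ y, kpow K n ξ y * v y = v ξ := by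
  induction n generalizing ξ with
  | zero => simp [kpow]
  | succ n ih =>
    simp only [kpow, Finset.sum_mul]
    rw [Finset.sum_comm]
    simp only [mul_assoc, ← Finset.mul_sum, ih, hv]

/-- Maximum principle: harmonic functions of an irreducible finite kernel are constant. -/
lemma harmonic_const {K : S → S → ℝ} (hK : ∀ ξ, ∑ y, K ξ y = 1) {n : ℕ}
    (hn : ∀ ξ ξ', 0 < kpow K n ξ ξ') {v : S → ℝ} (hv : ∀ ξ, ∑ y, K ξ y * v y = v ξ)
    (ξ ξ' : S) : v ξ = v ξ' := by
  have : Nonempty S := ⟨ξ⟩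
  obtain ⟨m, hm⟩ := Finite.exists_max v
  have key : ∑ y, kpow K n m y * (v m - v y) = 0 := by
    simp only [mul_sub, Finset.sum_sub_distrib, ← Finset.sum_mul, kpow_row_sum hK,
      kpow_harmonic hv, one_mul, sub_self]
  have h0 := (Finset.sum_eq_zero_iff_of_nonneg
    (fun y _ => mul_nonneg (hn m y).le (sub_nonneg.2 (hm y)))).1 key
  have h1 : ∀ y, v y = v m := fun y => by
    have := h0 y (Finset.mem_univ y)
    have := (mul_eq_zero.1 this).resolve_left (hn m y).ne'
    linarith
  rw [h1 ξ, h1 ξ']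

/-- The matrix `I - K + 1 dᵀ`, whose inverse is the fundamental matrix of the chain `K`. -/
def fundMatrix (K : S → S → ℝ) (d : S → ℝ) : Matrix S S ℝ :=
  Matrix.of fun ξ ξ' => (if ξ = ξ' then 1 else 0) - K ξ ξ' + d ξ'

lemma fundMatrix_mulVec (K : S → S → ℝ) (d v : S → ℝ) (ξ : S) :
    (fundMatrix K d).mulVec v ξ = v ξ - ∑ y, K ξ y * v y + ∑ y, d y * v y := by
  simp [Matrix.mulVec, dotProduct, fundMatrix, add_mul, sub_mul, Finset.sum_add_distrib,
    Finset.sum_sub_distrib]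

lemma stationary_dot_fundMatrix {K : S → S → ℝ} {d : S → ℝ} (hd : IsStationaryDist K d)
    (v : S → ℝ) : ∑ ξ, d ξ * (fundMatrix K d).mulVec v ξ = ∑ y, d y * v y := by
  have h : ∑ ξ, d ξ * ∑ y, K ξ y * v y = ∑ y, d y * v y := by
    simp only [Finset.mul_sum]
    rw [Finset.sum_comm]
    refine Finset.sum_congr rfl fun y _ => ?_
    rw [hd.2.2 y, Finset.sum_mul]
    simp only [mul_assoc]
  simp only [fundMatrix_mulVec, mul_add, mul_sub, Finset.sum_add_distrib,
    Finset.sum_sub_distrib, ← Finset.sum_mul, hd.2.1, h]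
  ring

lemma fundMatrix_det_ne_zero {K : S → S → ℝ} (hK : ∀ ξ, ∑ y, K ξ y = 1) {n : ℕ}
    (hn : ∀ ξ ξ', 0 < kpow K n ξ ξ') {d : S → ℝ} (hd : IsStationaryDist K d) :
    (fundMatrix K d).det ≠ 0 := by
  intro h
  obtain ⟨v, hv0, hv⟩ := Matrix.exists_mulVec_eq_zero_iff.2 h
  have hdv : ∑ y, d y * v y = 0 := by
    rw [← stationary_dot_fundMatrix hd v, hv]
    simp
  have hharm : ∀ ξ, ∑ y, K ξ y * v y = v ξ := fun ξ => by
    have := congrFun hv ξ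
    rw [fundMatrix_mulVec, hdv, Pi.zero_apply] at this
    linarith
  refine hv0 (funext fun ξ => ?_)
  have hc : ∑ y, d y * v y = v ξ := by
    simp only [fun y => harmonic_const hK hn hharm y ξ, ← Finset.sum_mul, hd.2.1, one_mul]
  rw [← hc, hdv, Pi.zero_apply]

/-- The solution of the Poisson equation for the chain `K` with forcing `h`. -/
def poissonSol (K : S → S → ℝ) (d h : S → ℝ) : S → ℝ := (fundMatrix K d)⁻¹.mulVec h

lemma poissonSol_spec {K : S → S → ℝ} (hK : ∀ ξ, ∑ y, K ξ y = 1) {n : ℕ}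
    (hn : ∀ ξ ξ', 0 < kpow K n ξ ξ') {d : S → ℝ} (hd : IsStationaryDist K d) (h : S → ℝ)
    (ξ : S) :
    poissonSol K d h ξ - ∑ y, K ξ y * poissonSol K d h y = h ξ - ∑ y, d y * h y := by
  have hM : (fundMatrix K d).mulVec (poissonSol K d h) = h := by
    rw [poissonSol, Matrix.mulVec_mulVec,
      Matrix.mul_nonsing_inv _ (fundMatrix_det_ne_zero hK hn hd).isUnit, Matrix.one_mulVec]
  have h1 := congrFun hM ξ
  have h2 := stationary_dot_fundMatrix hd (poissonSol K d h)
  rw [hM] at h2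
  rw [fundMatrix_mulVec] at h1
  linarith

lemma continuous_poissonSol {E : Type*} [TopologicalSpace E] {K : E → S → S → ℝ}
    {d h : E → S → ℝ} (hK : Continuous K) (hd : Continuous d) (hh : Continuous h)
    (hdet : ∀ z, (fundMatrix (K z) (d z)).det ≠ 0) :
    Continuous fun z => poissonSol (K z) (d z) (h z) := by
  have hM : Continuous fun z => fundMatrix (K z) (d z) := by
    refine continuous_matrix fun i j => ?_
    simp only [fundMatrix, Matrix.of_apply]
    fun_prop
  simp only [poissonSol, Matrix.inv_def, Ring.inverse_eq_inv']
  exact ((hM.matrix_det.inv₀ hdet).smul hM.matrix_adjugate).matrix_mulVec hh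

end PoissonEquation

section Martingale

variable {Ω : Type*} {mΩ : MeasurableSpace Ω} {P : Measure Ω} [IsProbabilityMeasure P]

lemma integral_mul_eq_zero_of_condExp {m : MeasurableSpace Ω} (hm : m ≤ mΩ) {f g : Ω → ℝ}
    (hf : Measurable[m] f) {c : ℝ} (hc : ∀ ω, |f ω| ≤ c) (hg : Integrable g P)
    (hg0 : P[g|m] =ᵐ[P] 0) : ∫ ω, f ω * g ω ∂P = 0 := by
  have h := condExp_stronglyMeasurable_mul_of_bound hm (μ := P) hf.stronglyMeasurable hg c
    (Eventually.of_forall hc)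
  have h2 : ∫ ω, (f * g) ω ∂P = ∫ ω, (0 : ℝ) ∂P := by
    rw [← integral_condExp hm]
    refine integral_congr_ae ?_
    filter_upwards [h, hg0] with ω h1 h2
    simp [h1, h2]
  simpa using h2

/-- Orthogonality of bounded martingale increments. -/
lemma integral_sq_martingale_sum_le (ℱ : Filtration ℕ mΩ) {D : ℕ → Ω → ℝ} {M : ℝ} {n : ℕ}
    (hD : ∀ k < n, Measurable[ℱ (k + 1)] (D k)) (hM : ∀ k < n, ∀ ω, |D k ω| ≤ M)
    (h0 : ∀ k < n, P[D k|ℱ k] =ᵐ[P] 0) :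
    Integrable (fun ω => (∑ k ∈ Finset.range n, D k ω) ^ 2) P ∧
      ∫ ω, (∑ k ∈ Finset.range n, D k ω) ^ 2 ∂P ≤ n * M ^ 2 := by
  have hSmeas : ∀ j ≤ n, Measurable[ℱ j] fun ω => ∑ k ∈ Finset.range j, D k ω := fun j hj =>
    Finset.measurable_fun_sum _ fun k hk => by
      have hk := Finset.mem_range.1 hk
      exact (hD k (by omega)).mono (ℱ.mono (by omega)) le_rfl
  have hSb : ∀ j ≤ n, ∀ ω, |∑ k ∈ Finset.range j, D k ω| ≤ j * M := fun j hj ω => by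
    refine (Finset.abs_sum_le_sum_abs _ _).trans ?_
    refine (Finset.sum_le_sum fun k hk => hM k ?_ ω).trans (by simp)
    have hk := Finset.mem_range.1 hk
    omega
  have hint : ∀ j ≤ n, Integrable (fun ω => (∑ k ∈ Finset.range j, D k ω) ^ 2) P :=
    fun j hj => Integrable.of_bound
      (((hSmeas j hj).mono (ℱ.le j) le_rfl).pow_const 2).aestronglyMeasurable ((j * M) ^ 2)
      (Eventually.of_forall fun ω => by
        rw [Real.norm_eq_abs, abs_pow]
        exact pow_le_pow_left₀ (abs_nonneg _) (hSb j hj ω) 2)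
  refine ⟨hint n le_rfl, ?_⟩
  suffices ∀ j ≤ n, ∫ ω, (∑ k ∈ Finset.range j, D k ω) ^ 2 ∂P ≤ j * M ^ 2 from this n le_rfl
  intro j hj
  induction j with
  | zero => simp
  | succ j ih =>
    have hjn : j < n := hj
    have hDm : Measurable (D j) := (hD j hjn).mono (ℱ.le _) le_rfl
    have hDi : Integrable (D j) P :=
      Integrable.of_bound hDm.aestronglyMeasurable M (Eventually.of_forall (hM j hjn))
    have hsq : ∀ ω, D j ω ^ 2 ≤ M ^ 2 := fun ω => by
      rw [← sq_abs]
      exact pow_le_pow_left₀ (abs_nonneg _) (hM j hjn ω) 2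
    have hDsq : Integrable (fun ω => D j ω ^ 2) P :=
      Integrable.of_bound (hDm.pow_const 2).aestronglyMeasurable (M ^ 2)
        (Eventually.of_forall fun ω => by
          rw [Real.norm_eq_abs, abs_of_nonneg (sq_nonneg _)]
          exact hsq ω)
    have hcross : Integrable (fun ω => (∑ k ∈ Finset.range j, D k ω) * D j ω) P :=
      hDi.bdd_mul ((hSmeas j hjn.le).mono (ℱ.le j) le_rfl).aestronglyMeasurable
        (Eventually.of_forall (hSb j hjn.le))
    have hzero := integral_mul_eq_zero_of_condExp (P := P) (ℱ.le j) (hSmeas j hjn.le)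
      (hSb j hjn.le) hDi (h0 j hjn)
    have hexp : ∀ ω, (∑ k ∈ Finset.range (j + 1), D k ω) ^ 2 =
        (∑ k ∈ Finset.range j, D k ω) ^ 2 + 2 * ((∑ k ∈ Finset.range j, D k ω) * D j ω) +
          D j ω ^ 2 := fun ω => by
      rw [Finset.sum_range_succ]
      ring
    simp only [hexp]
    have hDle : ∫ ω, D j ω ^ 2 ∂P ≤ M ^ 2 := by
      simpa using integral_mono hDsq (integrable_const (M ^ 2)) hsq
    have hfst : Integrable (fun ω => (∑ k ∈ Finset.range j, D k ω) ^ 2 +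
        2 * ((∑ k ∈ Finset.range j, D k ω) * D j ω)) P :=
      (hint j hjn.le).add (hcross.const_mul 2)
    rw [integral_add hfst hDsq,
      integral_add (hint j hjn.le) (hcross.const_mul 2), integral_const_mul, hzero]
    have := ih hjn.le
    push_cast
    linarith

end Martingale

lemma measurable_eval_finite {Ω S β : Type*} {m : MeasurableSpace Ω} [MeasurableSpace β]
    [Finite S] [MeasurableSpace S] [MeasurableSingletonClass S] {f : S → Ω → β} {u : Ω → S}
    (hf : ∀ s, Measurable (f s)) (hu : Measurable u) : Measurable fun ω => f (u ω) ω :=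
  (measurable_from_prod_countable_left (f := fun q : Ω × S => f q.2 q.1) hf).comp
    (measurable_id.prodMk hu)

section Averaging

variable {S : Type*} [Fintype S]

/-- Pathwise form of the Poisson-equation decomposition: up to the martingale part, the sum of
`ν - K ν` along a path telescopes when `ν` and `K ν` vary slowly. -/
lemma abs_sum_poisson_le {y : ℕ → S} {ν : ℕ → S → ℝ} {K : ℕ → S → S → ℝ} {B ε : ℝ} {n : ℕ}
    (hB : ∀ k ≤ n, ∀ ξ, |ν k ξ| ≤ B)
    (hν : ∀ k < n, ∀ ξ, |ν (k + 1) ξ - ν k ξ| ≤ ε)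
    (hK : ∀ k < n, ∀ ξ, |∑ z, K (k + 1) ξ z * ν k z - ∑ z, K k ξ z * ν k z| ≤ ε) :
    |∑ k ∈ Finset.range n, (ν k (y k) - ∑ z, K k (y k) z * ν k z)| ≤
      2 * B + 2 * n * ε + |∑ k ∈ Finset.range n,
        (ν k (y (k + 1)) - ∑ z, K (k + 1) (y k) z * ν k z)| := by
  have hdec : ∑ k ∈ Finset.range n, (ν k (y k) - ∑ z, K k (y k) z * ν k z) =
      (ν 0 (y 0) - ν n (y n)) +
      (∑ k ∈ Finset.range n, ((ν (k + 1) (y (k + 1)) - ν k (y (k + 1))) +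
        (∑ z, K (k + 1) (y k) z * ν k z - ∑ z, K k (y k) z * ν k z))) +
      ∑ k ∈ Finset.range n, (ν k (y (k + 1)) - ∑ z, K (k + 1) (y k) z * ν k z) := by
    rw [← Finset.sum_range_sub' (fun k => ν k (y k)), ← Finset.sum_add_distrib,
      ← Finset.sum_add_distrib]
    refine Finset.sum_congr rfl fun k _ => ?_
    ring
  have h1 : |ν 0 (y 0) - ν n (y n)| ≤ 2 * B := by
    have := abs_sub (ν 0 (y 0)) (ν n (y n))
    linarith [hB 0 (Nat.zero_le n) (y 0), hB n le_rfl (y n)]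
  have h2 : |∑ k ∈ Finset.range n, ((ν (k + 1) (y (k + 1)) - ν k (y (k + 1))) +
        (∑ z, K (k + 1) (y k) z * ν k z - ∑ z, K k (y k) z * ν k z))| ≤ 2 * n * ε := by
    refine (Finset.abs_sum_le_sum_abs _ _).trans ?_
    refine (Finset.sum_le_sum (g := fun _ => 2 * ε) fun k hk => ?_).trans (by simp; linarith)
    have hk := Finset.mem_range.1 hk
    refine (abs_add_le _ _).trans ?_
    linarith [hν k hk (y (k + 1)), hK k hk (y k)]
  rw [hdec]
  refine (abs_add_le _ _).trans (add_le_add_left ((abs_add_le _ _).trans (add_le_add h1 h2)) _)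

variable [DecidableEq S] [MeasurableSpace S] [MeasurableSingletonClass S]
  {Ω : Type*} {mΩ : MeasurableSpace Ω} {P : Measure Ω} [IsProbabilityMeasure P]

/-- A function observed at time `m` and evaluated at the next state of the chain, minus its
conditional expectation, is a martingale increment. -/
lemma condExp_chain_increment {m : MeasurableSpace Ω} (hm : m ≤ mΩ) {y' : Ω → S}
    {ν κ : Ω → S → ℝ} {B : ℝ} (hy' : Measurable[mΩ] y')
    (hν : ∀ ξ, Measurable[m] fun ω => ν ω ξ) (hκ : ∀ ξ, Measurable[m] fun ω => κ ω ξ)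
    (hB : ∀ ω ξ, |ν ω ξ| ≤ B)
    (hker : ∀ ξ', P[fun ω => if y' ω = ξ' then (1 : ℝ) else 0|m] =ᵐ[P] fun ω => κ ω ξ') :
    P[fun ω => ν ω (y' ω) - ∑ z, κ ω z * ν ω z|m] =ᵐ[P] 0 := by
  have hI : ∀ z, Integrable (fun ω => if y' ω = z then (1 : ℝ) else 0) P := fun z =>
    Integrable.of_bound (Measurable.ite (hy' (measurableSet_singleton z)) measurable_const
      measurable_const).aestronglyMeasurable 1
      (Eventually.of_forall fun ω => by split_ifs <;> simp)
  have hκi : ∀ z, Integrable (fun ω => κ ω z) P := fun z =>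
    (integrable_congr (hker z)).1 integrable_condExp
  have hdiff : ∀ z, Integrable ((fun ω => if y' ω = z then (1 : ℝ) else 0) - fun ω => κ ω z) P :=
    fun z => (hI z).sub (hκi z)
  have hrepr : (fun ω => ν ω (y' ω) - ∑ z, κ ω z * ν ω z) =
      ∑ z, (fun ω => ν ω z) * ((fun ω => if y' ω = z then (1 : ℝ) else 0) - fun ω => κ ω z) := by
    funext ω
    simp [mul_sub, Finset.sum_sub_distrib, mul_comm]
  have hzero : ∀ z, P[(fun ω => ν ω z) *
      ((fun ω => if y' ω = z then (1 : ℝ) else 0) - fun ω => κ ω z)|m] =ᵐ[P] 0 := fun z => by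
    filter_upwards [condExp_stronglyMeasurable_mul_of_bound hm (hν z).stronglyMeasurable
      (hdiff z) B (Eventually.of_forall fun ω => hB ω z), condExp_sub (hI z) (hκi z) m, hker z]
      with ω h1 h2 h3
    rw [h1, Pi.mul_apply, h2, Pi.sub_apply, h3,
      condExp_of_stronglyMeasurable hm (hκ z).stronglyMeasurable (hκi z)]
    simp
  rw [hrepr]
  have hsum := condExp_finsetSum (s := Finset.univ) (fun z _ => (hdiff z).bdd_mul
    ((hν z).mono hm le_rfl).aestronglyMeasurable (Eventually.of_forall fun ω => hB ω z)) m
  filter_upwards [hsum, ae_all_iff.2 hzero] with ω h' h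
  refine h'.trans ?_
  rw [Finset.sum_apply]
  exact Finset.sum_eq_zero fun z _ => h z

/-- Averaging for a controlled chain with slowly varying Poisson solutions `ν`. -/
lemma integral_abs_sum_poisson_le (ℱ : Filtration ℕ mΩ) {y : ℕ → Ω → S} {ν : ℕ → Ω → S → ℝ}
    {K : ℕ → Ω → S → S → ℝ} {B ε c : ℝ} {n : ℕ} (hc : 0 < c)
    (hy : ∀ k, Measurable[ℱ k] (y k))
    (hνm : ∀ k ξ, Measurable[ℱ k] fun ω => ν k ω ξ)
    (hKm : ∀ k ξ ξ', Measurable[ℱ k] fun ω => K (k + 1) ω ξ ξ')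
    (hker : ∀ k ξ', P[fun ω => if y (k + 1) ω = ξ' then (1 : ℝ) else 0|ℱ k]
      =ᵐ[P] fun ω => K (k + 1) ω (y k ω) ξ')
    (hB : ∀ k ≤ n, ∀ ω ξ, |ν k ω ξ| ≤ B)
    (hKB : ∀ k < n, ∀ ω ξ, |∑ z, K (k + 1) ω ξ z * ν k ω z| ≤ B)
    (hν : ∀ k < n, ∀ ω ξ, |ν (k + 1) ω ξ - ν k ω ξ| ≤ ε)
    (hK : ∀ k < n, ∀ ω ξ,
      |∑ z, K (k + 1) ω ξ z * ν k ω z - ∑ z, K k ω ξ z * ν k ω z| ≤ ε) :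
    ∫ ω, |∑ k ∈ Finset.range n, (ν k ω (y k ω) - ∑ z, K k ω (y k ω) z * ν k ω z)| ∂P ≤
      2 * B + 2 * n * ε + c + n * (2 * B) ^ 2 / c := by
  have hκm : ∀ k ξ', Measurable[ℱ k] fun ω => K (k + 1) ω (y k ω) ξ' := fun k ξ' =>
    measurable_eval_finite (f := fun ξ ω => K (k + 1) ω ξ ξ') (fun ξ => hKm k ξ ξ') (hy k)
  set D : ℕ → Ω → ℝ := fun k ω =>
    ν k ω (y (k + 1) ω) - ∑ z, K (k + 1) ω (y k ω) z * ν k ω z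
  have hDm : ∀ k < n, Measurable[ℱ (k + 1)] (D k) := fun k _ => by
    have hle := ℱ.mono (Nat.le_succ k)
    refine Measurable.sub (measurable_eval_finite (f := fun ξ ω => ν k ω ξ)
      (fun ξ => (hνm k ξ).mono hle le_rfl) (hy (k + 1))) ?_
    exact Finset.measurable_fun_sum _ fun z _ =>
      ((hκm k z).mono hle le_rfl).mul ((hνm k z).mono hle le_rfl)
  have hDb : ∀ k < n, ∀ ω, |D k ω| ≤ 2 * B := fun k hk ω => by
    have := abs_sub (ν k ω (y (k + 1) ω)) (∑ z, K (k + 1) ω (y k ω) z * ν k ω z)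
    linarith [hB k hk.le ω (y (k + 1) ω), hKB k hk ω (y k ω)]
  obtain ⟨hint, hsq⟩ := integral_sq_martingale_sum_le (P := P) ℱ hDm hDb fun k hk =>
    condExp_chain_increment (ℱ.le k) ((hy (k + 1)).mono (ℱ.le _) le_rfl) (hνm k) (hκm k)
      (hB k hk.le) (hker k)
  have hamgm : ∀ s : ℝ, |s| ≤ c + s ^ 2 / c := fun s => by
    rw [← sq_abs s, ← sub_le_iff_le_add', le_div_iff₀ hc]
    nlinarith [sq_nonneg (|s| - c), abs_nonneg s]
  have hmajor : Integrable (fun ω => 2 * B + 2 * n * ε + c +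
      (∑ k ∈ Finset.range n, D k ω) ^ 2 / c) P :=
    (integrable_const _).add (hint.div_const c)
  refine (integral_mono_of_nonneg (Eventually.of_forall fun ω => abs_nonneg _) hmajor
    (Eventually.of_forall fun ω => ?_)).trans ?_
  · refine (abs_sum_poisson_le (y := fun k => y k ω) (ν := fun k => ν k ω)
      (K := fun k => K k ω) (fun k hk => hB k hk ω) (fun k hk => hν k hk ω)
      (fun k hk => hK k hk ω)).trans ?_
    linarith [hamgm (∑ k ∈ Finset.range n, D k ω)]
  · rw [integral_add (integrable_const _) (hint.div_const c), integral_div]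
    simp only [integral_const, probReal_univ, smul_eq_mul, one_mul]
    gcongr

end Averaging

section Policies

variable {X A : Type*} [Fintype A]

lemma softmaxPol_nonneg (θ : X → A → ℝ) (x : X) (a : A) : 0 ≤ softmaxPol θ x a := by
  unfold softmaxPol
  positivity

lemma sum_exp_pos [Nonempty A] (θ : X → A → ℝ) (x : X) : 0 < ∑ a, Real.exp (θ x a) :=
  Finset.sum_pos (fun _ _ => Real.exp_pos _) Finset.univ_nonempty

lemma softmaxPol_sum [Nonempty A] (θ : X → A → ℝ) (x : X) : ∑ a, softmaxPol θ x a = 1 := by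
  simp only [softmaxPol, ← Finset.sum_div]
  exact div_self (sum_exp_pos θ x).ne'

lemma softmaxPol_isPolicy [Nonempty A] (θ : X → A → ℝ) : IsPolicy (softmaxPol θ) :=
  ⟨softmaxPol_nonneg θ, softmaxPol_sum θ⟩

lemma explorePol_isPolicy [Nonempty A] {η : ℝ} (h0 : 0 ≤ η) (h1 : η ≤ 1) (θ : X → A → ℝ) :
    IsPolicy (explorePol η θ) := by
  refine ⟨fun x a => ?_, fun x => ?_⟩
  · exact add_nonneg (by positivity) (mul_nonneg (by linarith) (softmaxPol_nonneg θ x a))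
  · simp only [explorePol, Finset.sum_add_distrib, ← Finset.mul_sum, softmaxPol_sum]
    simp
    field_simp
    ring

lemma IsPolicy.le_one {f : X → A → ℝ} (hf : IsPolicy f) (x : X) (a : A) : f x a ≤ 1 := by
  rw [← hf.2 x]
  exact Finset.single_le_sum (fun b _ => hf.1 x b) (Finset.mem_univ a)

lemma IsPolicy.abs_sum_mul_le {f : X → A → ℝ} (hf : IsPolicy f) {q : A → ℝ} {C : ℝ}
    (hq : ∀ a, |q a| ≤ C) (x : X) : |∑ a, q a * f x a| ≤ C := by
  refine (Finset.abs_sum_le_sum_abs _ _).trans ?_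
  calc ∑ a, |q a * f x a| ≤ ∑ a, C * f x a := Finset.sum_le_sum fun a _ => by
        rw [abs_mul, abs_of_nonneg (hf.1 x a)]
        exact mul_le_mul_of_nonneg_right (hq a) (hf.1 x a)
    _ = C := by rw [← Finset.mul_sum, hf.2, mul_one]

lemma continuous_softmaxPol [Nonempty A] :
    Continuous fun θ : X → A → ℝ => softmaxPol θ := by
  refine continuous_pi fun x => continuous_pi fun a => ?_
  simp only [softmaxPol]
  exact Continuous.div (by fun_prop) (by fun_prop) fun θ => (sum_exp_pos θ x).ne'

lemma actorKer_row_sum [Fintype X] {p : X → A → X → ℝ} {μ : X → ℝ} {γ : ℝ}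
    (hp1 : ∀ x a, ∑ x', p x a x' = 1) (hμ1 : ∑ x, μ x = 1) {f : X → A → ℝ}
    (hf : IsPolicy f) (ξ : X × A) : ∑ ξ', actorKer γ p μ f ξ ξ' = 1 := by
  simp only [actorKer, Fintype.sum_prod_type, ← Finset.mul_sum, hf.2, mul_one, ptilde,
    Finset.sum_add_distrib, hp1, hμ1]
  ring

lemma continuous_of_lipschitz_l1 [Fintype X] {σ : (X → A → ℝ) → X × A → ℝ} {L : ℝ}
    (hL : ∀ f f' : X → A → ℝ, ∑ ξ, |σ f ξ - σ f' ξ| ≤ L * ∑ x, ∑ a, |f x a - f' x a|) :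
    Continuous σ := by
  refine continuous_pi fun ξ => continuous_iff_continuousAt.2 fun f' => ?_
  refine tendsto_iff_dist_tendsto_zero.2 ?_
  have hlim : Tendsto (fun f : X → A → ℝ => L * ∑ x, ∑ a, |f x a - f' x a|) (nhds f')
      (nhds 0) := by
    have : Continuous fun f : X → A → ℝ => L * ∑ x, ∑ a, |f x a - f' x a| := by fun_prop
    simpa using this.tendsto f'
  refine squeeze_zero (fun _ => dist_nonneg) (fun f => ?_) hlim
  rw [Real.dist_eq]
  exact (Finset.single_le_sum (f := fun ξ => |σ f ξ - σ f' ξ|) (fun _ _ => abs_nonneg _)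
    (Finset.mem_univ ξ)).trans (hL f f')

end Policies

lemma zetaN_nonneg (N k : ℕ) : 0 ≤ zetaN N k := by
  unfold zetaN
  positivity

lemma zetaN_le_one (N k : ℕ) : zetaN N k ≤ 1 :=
  inv_le_one_of_one_le₀ (by linarith [show (0 : ℝ) ≤ (k : ℝ) / N by positivity])

lemma abs_zetaN_succ_sub_le (N k : ℕ) : |zetaN N (k + 1) - zetaN N k| ≤ 1 / N := by
  have h0 : (0 : ℝ) ≤ (k : ℝ) / N := by positivity
  have h1 : (0 : ℝ) ≤ 1 / (N : ℝ) := by positivity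
  have hrw : zetaN N (k + 1) - zetaN N k =
      -((1 / (N : ℝ)) * (zetaN N k * zetaN N (k + 1))) := by
    unfold zetaN
    have h2 : (((k + 1 : ℕ) : ℝ)) / N = (k : ℝ) / N + 1 / N := by
      push_cast
      ring
    rw [h2, inv_sub_inv (by linarith) (by linarith), ← mul_inv]
    rw [mul_comm (1 + (k : ℝ) / N)]
    ring
  rw [hrw, abs_neg, abs_of_nonneg (mul_nonneg h1 (mul_nonneg (zetaN_nonneg _ _)
    (zetaN_nonneg _ _)))]
  exact mul_le_of_le_one_right h1
    (mul_le_one₀ (zetaN_le_one _ _) (zetaN_nonneg _ _) (zetaN_le_one _ _))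

lemma etaN_nonneg (N k : ℕ) : 0 ≤ etaN N k := by
  unfold etaN
  positivity

lemma etaN_le_one (N k : ℕ) : etaN N k ≤ 1 :=
  inv_le_one_of_one_le₀ (by linarith [sq_nonneg (Real.log ((k : ℝ) / (N : ℝ) + 1))])

section Iterates

variable {X A : Type*} [Fintype A]

lemma critic_abs_le [DecidableEq X] [DecidableEq A] {q : ℕ → X → A → ℝ} {r : X → A → ℝ}
    {g : ℕ → X → A → ℝ} {xc : ℕ → X} {ac : ℕ → A} {β γ C : ℝ} (hβ0 : 0 ≤ β) (hβ1 : β ≤ 1)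
    (hγ : 0 ≤ γ) (hC : 1 + γ * C ≤ C) (hr : ∀ x a, 0 ≤ r x a ∧ r x a ≤ 1)
    (hg : ∀ k, IsPolicy (g k)) (h0 : ∀ x a, |q 0 x a| ≤ C)
    (hrec : ∀ k x a, q (k + 1) x a = q k x a + β * (r (xc k) (ac k) +
      γ * (∑ b, q k (xc (k + 1)) b * g k (xc (k + 1)) b) - q k (xc k) (ac k)) *
      (if xc k = x ∧ ac k = a then 1 else 0)) (k : ℕ) (x : X) (a : A) : |q k x a| ≤ C := by
  induction k generalizing x a with
  | zero => exact h0 x a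
  | succ k ih =>
    rw [hrec]
    split_ifs with h
    · obtain ⟨rfl, rfl⟩ := h
      have hV := abs_le.1 ((hg k).abs_sum_mul_le (fun b => ih (xc (k + 1)) b) (xc (k + 1)))
      have hq := abs_le.1 (ih (xc k) (ac k))
      have hr' := hr (xc k) (ac k)
      set V := ∑ b, q k (xc (k + 1)) b * g k (xc (k + 1)) b
      have hV1 : γ * V ≤ γ * C := mul_le_mul_of_nonneg_left hV.2 hγ
      have hV2 : -(γ * C) ≤ γ * V := by
        rw [← mul_neg]
        exact mul_le_mul_of_nonneg_left hV.1 hγ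
      rw [abs_le]
      constructor <;> nlinarith
    · simpa using ih x a

lemma critic_step_abs_le [DecidableEq X] [DecidableEq A] {q : X → A → ℝ} {r : X → A → ℝ}
    {g : X → A → ℝ} {β γ C : ℝ} (hβ0 : 0 ≤ β) (hγ : 0 ≤ γ) (hC : 1 + γ * C ≤ C)
    (hr : ∀ x a, 0 ≤ r x a ∧ r x a ≤ 1) (hg : IsPolicy g) (hq : ∀ x a, |q x a| ≤ C)
    (y y' x : X) (b a : A) :
    |β * (r y b + γ * (∑ c, q y' c * g y' c) - q y b) * (if y = x ∧ b = a then 1 else 0)| ≤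
      β * (2 * C) := by
  have hV := abs_le.1 (hg.abs_sum_mul_le (fun c => hq y' c) y')
  have hq' := abs_le.1 (hq y b)
  have hr' := hr y b
  set V := ∑ c, q y' c * g y' c
  have hV1 : γ * V ≤ γ * C := mul_le_mul_of_nonneg_left hV.2 hγ
  have hV2 : -(γ * C) ≤ γ * V := by
    rw [← mul_neg]
    exact mul_le_mul_of_nonneg_left hV.1 hγ
  have hin : |r y b + γ * V - q y b| ≤ 2 * C := abs_le.2 ⟨by linarith, by linarith⟩
  have hC0 : 0 ≤ 2 * C := (abs_nonneg _).trans hin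
  rw [abs_mul, abs_mul, abs_of_nonneg hβ0]
  refine (mul_le_of_le_one_right (by positivity) ?_).trans
    (mul_le_mul_of_nonneg_left hin hβ0)
  split_ifs <;> simp

lemma actor_step_abs_le [Nonempty A] [DecidableEq X] [DecidableEq A] {C s q : ℝ} (hs : 0 ≤ s)
    (hq : |q| ≤ C) (θ : X → A → ℝ) (y x : X) (b a : A) :
    |s * q * (if y = x then 1 else 0) * ((if b = a then 1 else 0) - softmaxPol θ y a)| ≤
      s * C := by
  have h0 := softmaxPol_nonneg θ y a
  have h1 := (softmaxPol_isPolicy θ).le_one y a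
  have h2 : |(if b = a then 1 else 0) - softmaxPol θ y a| ≤ 1 := by
    rw [abs_le]
    split_ifs <;> constructor <;> linarith
  have h3 : |(if y = x then (1 : ℝ) else 0)| ≤ 1 := by split_ifs <;> simp
  rw [abs_mul, abs_mul, abs_mul, abs_of_nonneg hs, mul_assoc]
  exact (mul_le_of_le_one_right (by positivity) (mul_le_one₀ h3 (abs_nonneg _) h2)).trans
    (mul_le_mul_of_nonneg_left hq hs)

lemma measurable_softmaxPol {Ω : Type*} {m : MeasurableSpace Ω} {θ : Ω → X → A → ℝ}
    (hθ : Measurable θ) (x : X) (a : A) : Measurable fun ω => softmaxPol (θ ω) x a := by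
  have h : ∀ b, Measurable fun ω => θ ω x b := fun b => by fun_prop
  simp only [softmaxPol]
  fun_prop

variable [Fintype X] [DecidableEq X] [DecidableEq A]
  [MeasurableSpace X] [MeasurableSingletonClass X]
  [MeasurableSpace A] [MeasurableSingletonClass A]
  {Ω : Type*} {mΩ : MeasurableSpace Ω}

lemma measurable_critic_succ {m : MeasurableSpace Ω} {ξ ξ' : Ω → X × A}
    {Q θ Q' : Ω → X → A → ℝ} {r : X → A → ℝ} {β γ η : ℝ}
    (hξ : Measurable ξ) (hξ' : Measurable ξ') (hQ : Measurable Q) (hθ : Measurable θ)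
    (hrec : ∀ ω x a, Q' ω x a = Q ω x a + β * (r (ξ ω).1 (ξ ω).2 +
      γ * (∑ b, Q ω (ξ' ω).1 b * explorePol η (θ ω) (ξ' ω).1 b) - Q ω (ξ ω).1 (ξ ω).2) *
      (if (ξ ω).1 = x ∧ (ξ ω).2 = a then 1 else 0)) : Measurable Q' := by
  refine measurable_pi_iff.2 fun x => measurable_pi_iff.2 fun a => ?_
  simp only [hrec]
  refine measurable_eval_finite (u := fun ω => (ξ ω, ξ' ω))
    (f := fun (z : (X × A) × (X × A)) ω => Q ω x a + β * (r z.1.1 z.1.2 +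
      γ * (∑ b, Q ω z.2.1 b * explorePol η (θ ω) z.2.1 b) - Q ω z.1.1 z.1.2) *
      (if z.1.1 = x ∧ z.1.2 = a then 1 else 0)) (fun z => ?_) (hξ.prodMk hξ')
  have h1 : ∀ x a, Measurable fun ω => Q ω x a := fun x a => by fun_prop
  have h2 : ∀ x a, Measurable fun ω => softmaxPol (θ ω) x a := measurable_softmaxPol hθ
  simp only [explorePol]
  fun_prop

lemma measurable_actor_succ {m : MeasurableSpace Ω} {ξ : Ω → X × A}
    {Q θ θ' : Ω → X → A → ℝ} {s : ℝ}
    (hξ : Measurable ξ) (hQ : Measurable Q) (hθ : Measurable θ)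
    (hrec : ∀ ω x a, θ' ω x a = θ ω x a + s * Q ω (ξ ω).1 (ξ ω).2 *
      (if (ξ ω).1 = x then 1 else 0) *
      ((if (ξ ω).2 = a then 1 else 0) - softmaxPol (θ ω) (ξ ω).1 a)) : Measurable θ' := by
  refine measurable_pi_iff.2 fun x => measurable_pi_iff.2 fun a => ?_
  simp only [hrec]
  refine measurable_eval_finite (u := ξ)
    (f := fun (z : X × A) ω => θ ω x a + s * Q ω z.1 z.2 * (if z.1 = x then 1 else 0) *
      ((if z.2 = a then 1 else 0) - softmaxPol (θ ω) z.1 a)) (fun z => ?_) hξ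
  have h1 : ∀ x a, Measurable fun ω => Q ω x a := fun x a => by fun_prop
  have h2 : ∀ x a, Measurable fun ω => θ ω x a := fun x a => by fun_prop
  have h3 : ∀ x a, Measurable fun ω => softmaxPol (θ ω) x a := measurable_softmaxPol hθ
  fun_prop

end Iterates

section Corrector

lemma continuous_actorKer_softmaxPol {X A : Type*} [Fintype A] [Nonempty A] (γ : ℝ) (p : X → A → X → ℝ) (μ : X → ℝ) :
    Continuous fun θ : X → A → ℝ => actorKer γ p μ (softmaxPol θ) :=
  continuous_pi fun _ => continuous_pi fun ξ' =>
    continuous_const.mul ((continuous_apply_apply ξ'.1 ξ'.2).comp continuous_softmaxPol)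

variable {X A : Type*} [Fintype A] [DecidableEq X] [DecidableEq A]

/-- The actor update direction at `z = (ζ, Q, θ)`, as a function of the sampled pair. -/
def actorForcing (x : X) (a : A) (z : ℝ × (X → A → ℝ) × (X → A → ℝ)) : X × A → ℝ :=
  fun ξ => z.1 * (z.2.1 ξ.1 ξ.2 * ((if ξ.1 = x then 1 else 0) *
    ((if ξ.2 = a then 1 else 0) - softmaxPol z.2.2 ξ.1 a)))

lemma continuous_actorForcing [Nonempty A] (x : X) (a : A) : Continuous (actorForcing x a) := by
  refine continuous_pi fun ξ => ?_
  have h : Continuous fun z : ℝ × (X → A → ℝ) × (X → A → ℝ) => softmaxPol z.2.2 ξ.1 a :=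
    (continuous_apply_apply ξ.1 a).comp (continuous_softmaxPol.comp continuous_snd.snd)
  unfold actorForcing
  fun_prop

/-- The Poisson corrector associated with `actorForcing`. -/
def actorCorrector [Fintype X] (γ : ℝ) (p : X → A → X → ℝ) (μ : X → ℝ)
    (σ : (X → A → ℝ) → X × A → ℝ) (x : X) (a : A) (z : ℝ × (X → A → ℝ) × (X → A → ℝ)) :
    X × A → ℝ :=
  poissonSol (actorKer γ p μ (softmaxPol z.2.2)) (σ (softmaxPol z.2.2)) (actorForcing x a z)

variable [Fintype X] [Nonempty A] {γ : ℝ} {p : X → A → X → ℝ} {μ : X → ℝ}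
  {σ : (X → A → ℝ) → X × A → ℝ}

lemma continuous_actorCorrector (hp1 : ∀ x a, ∑ x', p x a x' = 1) (hμ1 : ∑ x, μ x = 1)
    (hσ : ∀ θ, IsStationaryDist (actorKer γ p μ (softmaxPol θ)) (σ (softmaxPol θ)))
    (hσc : Continuous σ)
    (herg : ∀ θ : X → A → ℝ, ∃ n, 0 < n ∧
      ∀ ξ ξ' : X × A, 0 < kpow (actorKer γ p μ (softmaxPol θ)) n ξ ξ') (x : X) (a : A) :
    Continuous (actorCorrector γ p μ σ x a) := by
  refine continuous_poissonSol
    ((continuous_actorKer_softmaxPol γ p μ).comp continuous_snd.snd)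
    (hσc.comp (continuous_softmaxPol.comp continuous_snd.snd))
    (continuous_actorForcing x a) fun z => ?_
  obtain ⟨n, -, hn⟩ := herg z.2.2
  exact fundMatrix_det_ne_zero (actorKer_row_sum hp1 hμ1 (softmaxPol_isPolicy _)) hn (hσ _)

lemma actorCorrector_spec (hp1 : ∀ x a, ∑ x', p x a x' = 1) (hμ1 : ∑ x, μ x = 1)
    (hσ : ∀ θ, IsStationaryDist (actorKer γ p μ (softmaxPol θ)) (σ (softmaxPol θ)))
    (herg : ∀ θ : X → A → ℝ, ∃ n, 0 < n ∧
      ∀ ξ ξ' : X × A, 0 < kpow (actorKer γ p μ (softmaxPol θ)) n ξ ξ') (x : X) (a : A)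
    (z : ℝ × (X → A → ℝ) × (X → A → ℝ)) (ξ : X × A) :
    actorCorrector γ p μ σ x a z ξ -
        ∑ y, actorKer γ p μ (softmaxPol z.2.2) ξ y * actorCorrector γ p μ σ x a z y =
      z.1 * (z.2.1 ξ.1 ξ.2 * ((if ξ.1 = x then 1 else 0) *
          ((if ξ.2 = a then 1 else 0) - softmaxPol z.2.2 ξ.1 a)) -
        ∑ y : X × A, z.2.1 y.1 y.2 * ((if y.1 = x then 1 else 0) *
          ((if y.2 = a then 1 else 0) - softmaxPol z.2.2 y.1 a)) * σ (softmaxPol z.2.2) y) := by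
  obtain ⟨n, -, hn⟩ := herg z.2.2
  unfold actorCorrector
  rw [poissonSol_spec (actorKer_row_sum hp1 hμ1 (softmaxPol_isPolicy _)) hn (hσ _), mul_sub,
    Finset.mul_sum]
  simp only [actorForcing]
  congr 1
  refine Finset.sum_congr rfl fun y _ => ?_
  ring

end Corrector

/-- A continuous map on a proper space is bounded and uniformly continuous on closed balls. -/
lemma exists_bound_and_modulus {E V : Type*} [PseudoMetricSpace E] [ProperSpace E]
    [SeminormedAddCommGroup V] {f : E → V} (hf : Continuous f) (z₀ : E) (R : ℝ) :
    ∃ B, (∀ z ∈ Metric.closedBall z₀ R, ‖f z‖ ≤ B) ∧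
      ∀ ε > 0, ∃ δ > 0, ∀ z ∈ Metric.closedBall z₀ R, ∀ w ∈ Metric.closedBall z₀ R,
        dist z w < δ → dist (f z) (f w) < ε := by
  have hK := isCompact_closedBall z₀ R
  obtain ⟨B, hB⟩ := hK.exists_bound_of_continuousOn hf.continuousOn
  exact ⟨B, hB, Metric.uniformContinuousOn_iff.1
    (hK.uniformContinuousOn_of_continuous hf.continuousOn)⟩

lemma norm_le_of_forall_abs_le {X A : Type*} [Fintype X] [Fintype A] {q : X → A → ℝ} {C : ℝ}
    (hC : 0 ≤ C) (h : ∀ x a, |q x a| ≤ C) : ‖q‖ ≤ C :=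
  (pi_norm_le_iff_of_nonneg hC).2 fun x => (pi_norm_le_iff_of_nonneg hC).2 fun a => h x a

theorem actor_fluctuation_process_vanishes
    {X A : Type*} [Fintype X] [Fintype A] [Nonempty X] [Nonempty A]
    [DecidableEq X] [DecidableEq A]
    (p : X → A → X → ℝ) (μ : X → ℝ) (r : X → A → ℝ) (γ α : ℝ)
    (hp0 : ∀ x a x', 0 ≤ p x a x') (hp1 : ∀ x a, ∑ x', p x a x' = 1)
    (hμ0 : ∀ x, 0 ≤ μ x) (hμ1 : ∑ x, μ x = 1)
    (hr : ∀ x a, 0 ≤ r x a ∧ r x a ≤ 1) (hγ : 0 < γ ∧ γ < 1) (hα : 0 < α)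
    (sigsta : (X → A → ℝ) → X × A → ℝ)
    (hsig : ∀ θ : X → A → ℝ,
      IsStationaryDist (actorKer γ p μ (softmaxPol θ)) (sigsta (softmaxPol θ)))
    (hsigLip : ∃ L : ℝ, ∀ f f' : X → A → ℝ,
      ∑ ξ : X × A, |sigsta f ξ - sigsta f' ξ| ≤ L * ∑ x, ∑ a, |f x a - f' x a|)
    (hergA : ∀ θ : X → A → ℝ, ∃ n, 0 < n ∧
      ∀ ξ ξ' : X × A, 0 < kpow (actorKer γ p μ (softmaxPol θ)) n ξ ξ')
    {Ω : Type*} [mΩ : MeasurableSpace Ω] (P : Measure Ω) [IsProbabilityMeasure P]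
    [MeasurableSpace X] [MeasurableSingletonClass X]
    [MeasurableSpace A] [MeasurableSingletonClass A]
    (Q0 θ0 : X → A → ℝ)
    (F : ℕ → MeasureTheory.Filtration ℕ mΩ)
    (xc : ℕ → ℕ → Ω → X) (ac : ℕ → ℕ → Ω → A)
    (xa : ℕ → ℕ → Ω → X) (aa : ℕ → ℕ → Ω → A)
    (Q θ : ℕ → ℕ → Ω → X → A → ℝ)
    (hQinit : ∀ N ω, Q N 0 ω = Q0) (hθinit : ∀ N ω, θ N 0 ω = θ0)
    (hQrec : ∀ N k ω x a, Q N (k + 1) ω x a = Q N k ω x a + (α / N) *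
      (r (xc N k ω) (ac N k ω) + γ * (∑ a'', Q N k ω (xc N (k + 1) ω) a'' *
          explorePol (etaN N k) (θ N k ω) (xc N (k + 1) ω) a'')
        - Q N k ω (xc N k ω) (ac N k ω)) *
      (if xc N k ω = x ∧ ac N k ω = a then 1 else 0))
    (hθrec : ∀ N k ω x a, θ N (k + 1) ω x a = θ N k ω x a + (zetaN N k / N) *
      Q N k ω (xa N k ω) (aa N k ω) * (if xa N k ω = x then 1 else 0) *
      ((if aa N k ω = a then 1 else 0) - softmaxPol (θ N k ω) (xa N k ω) a))
    (hadaptc : ∀ N k, Measurable[(F N) k] fun ω => (xc N k ω, ac N k ω))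
    (hadapta : ∀ N k, Measurable[(F N) k] fun ω => (xa N k ω, aa N k ω))
    (hMarkovC : ∀ N k (ξ' : X × A),
      (P[(fun ω => if (xc N (k + 1) ω, ac N (k + 1) ω) = ξ' then (1 : ℝ) else 0)|(F N) k])
        =ᵐ[P] fun ω => p (xc N k ω) (ac N k ω) ξ'.1 *
          explorePol (etaN N (k + 1)) (θ N (k + 1) ω) ξ'.1 ξ'.2)
    (hMarkovA : ∀ N k (ξ' : X × A),
      (P[(fun ω => if (xa N (k + 1) ω, aa N (k + 1) ω) = ξ' then (1 : ℝ) else 0)|(F N) k])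
        =ᵐ[P] fun ω => ptilde γ p μ (xa N k ω) (aa N k ω) ξ'.1 *
          softmaxPol (θ N (k + 1) ω) ξ'.1 ξ'.2)
    (x : X) (a : A) (T : ℝ) (hT : 0 < T) :
    Tendsto (fun N : ℕ => ⨆ t : Set.Ioc (0 : ℝ) T, ∫ ω,
        |(1 / (N : ℝ)) * ∑ k ∈ Finset.range ⌊(N : ℝ) * (t : ℝ)⌋₊,
            zetaN N k * (Q N k ω (xa N k ω) (aa N k ω) *
                ((if xa N k ω = x then 1 else 0) *
                  ((if aa N k ω = a then 1 else 0) - softmaxPol (θ N k ω) (xa N k ω) a)) -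
              ∑ ξ' : X × A, Q N k ω ξ'.1 ξ'.2 *
                ((if ξ'.1 = x then 1 else 0) *
                  ((if ξ'.2 = a then 1 else 0) - softmaxPol (θ N k ω) ξ'.1 a)) *
                sigsta (softmaxPol (θ N k ω)) ξ')| ∂P)
      atTop (nhds 0) := by
  obtain ⟨L, hL⟩ := hsigLip
  set G := actorCorrector γ p μ sigsta x a
  have hG : Continuous G :=
    continuous_actorCorrector hp1 hμ1 hsig (continuous_of_lipschitz_l1 hL) hergA x a
  set Φ : (ℝ × (X → A → ℝ) × (X → A → ℝ)) × (ℝ × (X → A → ℝ) × (X → A → ℝ)) → X × A → ℝ :=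
    fun w ξ => ∑ y, actorKer γ p μ (softmaxPol w.2.2.2) ξ y * G w.1 y
  have hΦ : Continuous Φ := by
    refine continuous_pi fun ξ => continuous_finsetSum _ fun y _ => ?_
    exact ((continuous_apply_apply ξ y).comp ((continuous_actorKer_softmaxPol γ p μ).comp
      continuous_snd.snd.snd)).mul ((continuous_apply y).comp (hG.comp continuous_fst))
  set C : ℝ := max ‖Q0‖ (1 / (1 - γ))
  have hγ1 : 0 < 1 - γ := by linarith [hγ.2]
  have hCγ : 1 + γ * C ≤ C := by
    have := (div_le_iff₀ hγ1).1 (le_max_right ‖Q0‖ (1 / (1 - γ)))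
    linarith
  have hC0 : 0 ≤ C := (norm_nonneg Q0).trans (le_max_left _ _)
  set Λ : ℝ := 1 + 2 * α * C + C
  set R : ℝ := 1 + C + ‖θ0‖ + C * T
  obtain ⟨B₁, hB₁, hmodG⟩ := exists_bound_and_modulus hG 0 R
  obtain ⟨B₂, hB₂, hmodΦ⟩ := exists_bound_and_modulus hΦ 0 R
  set B := max B₁ B₂
  rw [Metric.tendsto_atTop']
  intro e he
  set ε : ℝ := e / (16 * T) with hεdef
  have hε : 0 < ε := by positivity
  obtain ⟨δ₁, hδ₁, hδG⟩ := hmodG ε hε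
  obtain ⟨δ₂, hδ₂, hδΦ⟩ := hmodΦ ε hε
  have hev : ∀ᶠ N : ℕ in atTop, 1 ≤ N ∧ α ≤ N ∧ Λ / N < min δ₁ δ₂ ∧
      (2 * B + T * (2 * B) ^ 2 / (e / 8)) / N < e / 4 := by
    refine (eventually_ge_atTop 1).and ((tendsto_natCast_atTop_atTop.eventually_ge_atTop α).and
      (Eventually.and ?_ ?_))
    · exact (tendsto_const_div_atTop_nhds_zero_nat Λ).eventually_lt_const (lt_min hδ₁ hδ₂)
    · exact (tendsto_const_div_atTop_nhds_zero_nat _).eventually_lt_const (by positivity)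
  obtain ⟨N₀, hN₀⟩ := eventually_atTop.1 hev
  refine ⟨N₀, fun N hN => ?_⟩
  obtain ⟨hN1, hNα, hNδ, hNe⟩ := hN₀ N hN.le
  have hNpos : (0 : ℝ) < N := by exact_mod_cast hN1
  have hβ0 : 0 ≤ α / N := by positivity
  have hβ1 : α / N ≤ 1 := (div_le_one hNpos).2 hNα
  have hexp : ∀ k ω, IsPolicy (explorePol (etaN N k) (θ N k ω)) := fun k ω =>
    explorePol_isPolicy (etaN_nonneg N k) (etaN_le_one N k) _
  have hQb : ∀ k ω x a, |Q N k ω x a| ≤ C := fun k ω => by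
    refine critic_abs_le (q := fun k => Q N k ω) (g := fun k => explorePol (etaN N k) (θ N k ω))
      hβ0 hβ1 hγ.1.le hCγ hr (fun k => hexp k ω) (fun x a => ?_) (fun k => hQrec N k ω) k
    rw [hQinit]
    exact ((norm_le_pi_norm (Q0 x) a).trans (norm_le_pi_norm Q0 x)).trans (le_max_left _ _)
  have hθstep : ∀ k ω, dist (θ N (k + 1) ω) (θ N k ω) ≤ C / N := fun k ω => by
    rw [dist_eq_norm]
    refine norm_le_of_forall_abs_le (by positivity) fun x a => ?_
    rw [Pi.sub_apply, Pi.sub_apply, hθrec, add_sub_cancel_left]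
    refine (actor_step_abs_le (div_nonneg (zetaN_nonneg N k) hNpos.le) (hQb k ω _ _) _ _ _ _
      _).trans ?_
    rw [div_mul_eq_mul_div]
    gcongr
    exact mul_le_of_le_one_left hC0 (zetaN_le_one N k)
  have hQstep : ∀ k ω, dist (Q N (k + 1) ω) (Q N k ω) ≤ 2 * α * C / N := fun k ω => by
    rw [dist_eq_norm]
    refine norm_le_of_forall_abs_le (by positivity) fun x a => ?_
    rw [Pi.sub_apply, Pi.sub_apply, hQrec, add_sub_cancel_left]
    refine (critic_step_abs_le hβ0 hγ.1.le hCγ hr (hexp k ω) (hQb k ω) _ _ _ _ _).trans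
      (le_of_eq ?_)
    ring
  set z : ℕ → Ω → ℝ × (X → A → ℝ) × (X → A → ℝ) := fun k ω => (zetaN N k, Q N k ω, θ N k ω)
  have hzstep : ∀ k ω, dist (z (k + 1) ω) (z k ω) ≤ Λ / N := fun k ω => by
    have h1 : 1 / (N : ℝ) ≤ Λ / N := by
      gcongr
      linarith [show 0 ≤ 2 * α * C by positivity]
    have h2 : 2 * α * C / N ≤ Λ / N := by
      gcongr
      linarith
    have h3 : C / N ≤ Λ / N := by
      gcongr
      linarith [show 0 ≤ 2 * α * C by positivity]
    exact max_le ((abs_zetaN_succ_sub_le N k).trans h1)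
      (max_le ((hQstep k ω).trans h2) ((hθstep k ω).trans h3))
  have hθb : ∀ k ω, ‖θ N k ω‖ ≤ ‖θ0‖ + k * (C / N) := fun k ω => by
    induction k with
    | zero => simp [hθinit]
    | succ k ih =>
      have h1 := hθstep k ω
      rw [dist_eq_norm] at h1
      have h2 := norm_le_norm_add_norm_sub' (θ N (k + 1) ω) (θ N k ω)
      push_cast
      linarith
  have hball : ∀ k : ℕ, (k : ℝ) ≤ N * T → ∀ ω, z k ω ∈ Metric.closedBall 0 R := fun k hk ω => by
    have hCT : 0 ≤ C * T := by positivity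
    have h1 : (k : ℝ) * (C / N) ≤ C * T := by
      rw [mul_div_assoc', div_le_iff₀ hNpos]
      nlinarith
    rw [mem_closedBall_zero_iff]
    refine max_le ?_ (max_le ?_ ?_)
    · rw [Real.norm_eq_abs, abs_of_nonneg (zetaN_nonneg N k)]
      linarith [zetaN_le_one N k, norm_nonneg θ0]
    · linarith [norm_le_of_forall_abs_le hC0 (hQb k ω), norm_nonneg θ0]
    · linarith [hθb k ω]
  have hmeas : ∀ k, Measurable[(F N) k] (Q N k) ∧ Measurable[(F N) k] (θ N k) := fun k => by
    induction k with
    | zero =>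
      rw [show Q N 0 = fun _ => Q0 from funext (hQinit N),
        show θ N 0 = fun _ => θ0 from funext (hθinit N)]
      exact ⟨measurable_const, measurable_const⟩
    | succ k ih =>
      have hle := (F N).mono (Nat.le_succ k)
      exact ⟨measurable_critic_succ ((hadaptc N k).mono hle le_rfl) (hadaptc N (k + 1))
          (ih.1.mono hle le_rfl) (ih.2.mono hle le_rfl) (hQrec N k),
        (measurable_actor_succ (hadapta N k) ih.1 ih.2 (hθrec N k)).mono hle le_rfl⟩
  have hθpred : ∀ k, Measurable[(F N) k] (θ N (k + 1)) := fun k =>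
    measurable_actor_succ (hadapta N k) (hmeas k).1 (hmeas k).2 (hθrec N k)
  have hbound : ∀ t : Set.Ioc (0 : ℝ) T, ∫ ω,
        |(1 / (N : ℝ)) * ∑ k ∈ Finset.range ⌊(N : ℝ) * (t : ℝ)⌋₊,
            zetaN N k * (Q N k ω (xa N k ω) (aa N k ω) *
                ((if xa N k ω = x then 1 else 0) *
                  ((if aa N k ω = a then 1 else 0) - softmaxPol (θ N k ω) (xa N k ω) a)) -
              ∑ ξ' : X × A, Q N k ω ξ'.1 ξ'.2 *
                ((if ξ'.1 = x then 1 else 0) *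
                  ((if ξ'.2 = a then 1 else 0) - softmaxPol (θ N k ω) ξ'.1 a)) *
                sigsta (softmaxPol (θ N k ω)) ξ')| ∂P ≤ e / 2 := by
    rintro ⟨t, ht0, htT⟩
    set n := ⌊(N : ℝ) * t⌋₊
    have hnT : (n : ℝ) ≤ N * T :=
      (Nat.floor_le (by positivity)).trans (mul_le_mul_of_nonneg_left htT hNpos.le)
    have hballn : ∀ k ≤ n, ∀ ω, z k ω ∈ Metric.closedBall 0 R := fun k hk =>
      hball k ((Nat.cast_le.2 hk).trans hnT)
    have hpair : ∀ {u w : ℝ × (X → A → ℝ) × (X → A → ℝ)}, u ∈ Metric.closedBall 0 R →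
        w ∈ Metric.closedBall 0 R → (u, w) ∈ Metric.closedBall (0 : (ℝ × (X → A → ℝ) ×
          (X → A → ℝ)) × (ℝ × (X → A → ℝ) × (X → A → ℝ))) R := fun hu hw => by
      rw [← Prod.mk_zero_zero, ← closedBall_prod_same]
      exact ⟨hu, hw⟩
    have havg := integral_abs_sum_poisson_le (P := P) (F N) (n := n) (B := B) (ε := ε)
      (c := N * (e / 8)) (y := fun k ω => (xa N k ω, aa N k ω)) (ν := fun k ω => G (z k ω))
      (K := fun k ω => actorKer γ p μ (softmaxPol (θ N k ω)))
      (by positivity) (hadapta N)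
      (fun k ξ => ((continuous_apply ξ).comp hG).measurable.comp
        (measurable_const.prodMk ((hmeas k).1.prodMk (hmeas k).2)))
      (fun k ξ ξ' => measurable_const.mul (measurable_softmaxPol (hθpred k) ξ'.1 ξ'.2))
      (hMarkovA N)
      (fun k hk ω ξ => ((norm_le_pi_norm (G (z k ω)) ξ).trans (hB₁ _ (hballn k hk ω))).trans
        (le_max_left _ _))
      (fun k hk ω ξ => ((norm_le_pi_norm (Φ (z k ω, z (k + 1) ω)) ξ).trans
        (hB₂ _ (hpair (hballn k hk.le ω) (hballn (k + 1) hk ω)))).trans (le_max_right _ _))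
      (fun k hk ω ξ => (dist_le_pi_dist (G (z (k + 1) ω)) (G (z k ω)) ξ).trans
        (hδG _ (hballn (k + 1) hk ω) _ (hballn k hk.le ω)
          ((hzstep k ω).trans_lt (hNδ.trans_le (min_le_left _ _)))).le)
      (fun k hk ω ξ => (dist_le_pi_dist (Φ (z k ω, z (k + 1) ω)) (Φ (z k ω, z k ω)) ξ).trans
        (hδΦ _ (hpair (hballn k hk.le ω) (hballn (k + 1) hk ω)) _
          (hpair (hballn k hk.le ω) (hballn k hk.le ω)) (by
            rw [Prod.dist_eq, dist_self]
            exact max_lt (lt_min hδ₁ hδ₂ |>.trans_le (min_le_right _ _))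
              ((hzstep k ω).trans_lt (hNδ.trans_le (min_le_right _ _))))).le)
    have hspec : ∀ k ω, G (z k ω) (xa N k ω, aa N k ω) -
        ∑ y, actorKer γ p μ (softmaxPol (θ N k ω)) (xa N k ω, aa N k ω) y * G (z k ω) y = _ :=
      fun k ω => actorCorrector_spec hp1 hμ1 hsig hergA x a (z k ω) (xa N k ω, aa N k ω)
    simp only [hspec] at havg
    simp only [abs_mul, abs_of_pos (one_div_pos.2 hNpos), integral_const_mul]
    refine (mul_le_mul_of_nonneg_left havg (one_div_pos.2 hNpos).le).trans ?_
    have h1 : 2 * (n : ℝ) * ε ≤ N * (e / 8) := by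
      calc 2 * (n : ℝ) * ε ≤ 2 * (N * T) * ε := by gcongr
        _ = N * (e / 8) := by
          rw [hεdef]
          field_simp
          norm_num
    have h2 : (n : ℝ) * (2 * B) ^ 2 / (N * (e / 8)) ≤ T * (2 * B) ^ 2 / (e / 8) := by
      calc (n : ℝ) * (2 * B) ^ 2 / (N * (e / 8)) ≤ N * T * (2 * B) ^ 2 / (N * (e / 8)) := by
            gcongr
        _ = T * (2 * B) ^ 2 / (e / 8) := by
          rw [mul_assoc, mul_div_mul_left _ _ hNpos.ne']
    have h3 := (div_lt_iff₀ hNpos).1 hNe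
    rw [one_div_mul_eq_div, div_le_iff₀ hNpos]
    linarith
  rw [Real.dist_eq, sub_zero,
    abs_of_nonneg (Real.iSup_nonneg fun t => integral_nonneg fun ω => abs_nonneg _)]
  exact (Real.iSup_le hbound (by positivity)).trans_lt (by linarith)
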